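/- There exists an absolute constant c > 0 such that every regular finite simple graph with m edges that contains no cycle of length 5 has surplus at least c · m^(6/7). -/

import Mathlib

namespace MaxCutPaper

variable {V : Type*}

/-- The size of the cut induced by a vertex subset `S`: the number of edges of `G`
with one endpoint in `S` and the other outside `S` (counted via ordered pairs with
first coordinate in `S`). -/
noncomputable def cutSize [Fintype V] (G : SimpleGraph V) (S : Finset V) : ℕ :=
  Nat.card {p : V × V // p.1 ∈ S ∧ p.2 ∉ S ∧ G.Adj p.1 p.2}

/-- The maximum size of a cut of `G`. -/
noncomputable def maxCut [Fintype V] (G : SimpleGraph V) : ℕ :=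
  (Finset.univ : Finset V).powerset.sup (cutSize G)

/-- The number of edges of `G`. -/
noncomputable def edgeCount (G : SimpleGraph V) : ℕ := Nat.card G.edgeSet

/-- The surplus of `G`: `mc(G) - e(G)/2`. -/
noncomputable def surplus [Fintype V] (G : SimpleGraph V) : ℝ :=
  (maxCut G : ℝ) - (edgeCount G : ℝ) / 2

/-- The degree of a vertex. -/
noncomputable def degC (G : SimpleGraph V) (v : V) : ℕ := Nat.card (G.neighborSet v)

/-- The number of copies of `K_r` in `G`, i.e. `r`-element sets of pairwise adjacent
vertices. -/
noncomputable def cliqueCount (G : SimpleGraph V) (r : ℕ) : ℕ :=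
  Nat.card {s : Finset V // G.IsNClique r s}

/-- `G` contains no cycle of length `r`. -/
def CycleFree (G : SimpleGraph V) (r : ℕ) : Prop :=
  ∀ ⦃v : V⦄ (w : G.Walk v v), w.IsCycle → w.length ≠ r

/-- `G` is `d`-degenerate (for a real `d ≥ 0`): every (induced) subgraph has a vertex of
degree at most `d`. -/
def Degenerate (G : SimpleGraph V) (d : ℝ) : Prop :=
  ∀ B : Finset V, B.Nonempty → ∃ v ∈ B, (Nat.card {u : V // u ∈ B ∧ G.Adj v u} : ℝ) ≤ d

/-- The number of edges of `G` with both endpoints in `T`. -/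
noncomputable def edgesIn (G : SimpleGraph V) (T : Finset V) : ℝ :=
  (Nat.card {p : V × V // p.1 ∈ T ∧ p.2 ∈ T ∧ G.Adj p.1 p.2} : ℝ) / 2

open Finset MeasureTheory ProbabilityTheory

section Rounding

/-- A function that is affine in every coordinate separately takes, at some sign vector, a value
at most its value at a given point of the cube `[-1, 1] ^ V`. -/
lemma exists_sign_le_of_multiaffine {V : Type*} [Fintype V] [DecidableEq V] (Q : (V → ℝ) → ℝ)
    (hQ : ∀ y v, ∃ a b : ℝ, ∀ t, Q (Function.update y v t) = a + b * t)
    (y : V → ℝ) (hy : ∀ v, |y v| ≤ 1) :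
    ∃ σ : V → ℝ, (∀ v, σ v = 1 ∨ σ v = -1) ∧ Q σ ≤ Q y := by
  suffices h : ∀ s : Finset V, ∃ σ : V → ℝ, (∀ v, |σ v| ≤ 1) ∧
      (∀ v ∈ s, σ v = 1 ∨ σ v = -1) ∧ Q σ ≤ Q y by
    obtain ⟨σ, -, h1, h2⟩ := h univ
    exact ⟨σ, fun v => h1 v (mem_univ v), h2⟩
  intro s
  induction s using Finset.induction_on with
  | empty => exact ⟨y, hy, by simp, le_rfl⟩
  | insert v s hv ih =>
    obtain ⟨σ, h1, h2, h3⟩ := ih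
    obtain ⟨a, b, hab⟩ := hQ σ v
    have hσ : Q σ = a + b * σ v := by rw [← hab, Function.update_eq_self]
    have hv1 := abs_le.1 (h1 v)
    obtain ⟨ε, hε, hle⟩ : ∃ ε : ℝ, (ε = 1 ∨ ε = -1) ∧ a + b * ε ≤ a + b * σ v := by
      rcases le_total 0 b with hb | hb
      · exact ⟨-1, Or.inr rfl, by nlinarith⟩
      · exact ⟨1, Or.inl rfl, by nlinarith⟩
    refine ⟨Function.update σ v ε, fun w => ?_, fun w hw => ?_, ?_⟩
    · by_cases hwv : w = v
      · subst hwv; rcases hε with rfl | rfl <;> simp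
      · simpa [hwv] using h1 w
    · by_cases hwv : w = v
      · subst hwv; simpa using hε
      · simpa [hwv] using h2 w (mem_of_mem_insert_of_ne hw hwv)
    · rw [hab]; linarith

end Rounding

section Gaussian

variable {E : Type*} [NormedAddCommGroup E] [InnerProductSpace ℝ E] [FiniteDimensional ℝ E]
  [MeasurableSpace E] [BorelSpace E]

lemma integral_cos_inner_stdGaussian (t : E) :
    ∫ g, Real.cos (inner ℝ g t) ∂(stdGaussian E) = Real.exp (-‖t‖ ^ 2 / 2) := by
  have h := charFun_stdGaussian t
  rw [charFun_apply] at h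
  have hi : Integrable (fun g : E => Complex.exp (inner ℝ g t * Complex.I)) (stdGaussian E) := by
    refine Integrable.of_bound (C := 1) (by fun_prop) (.of_forall fun g => ?_)
    rw [Complex.norm_exp_ofReal_mul_I]
  have h2 := congrArg Complex.re h
  have h3 := integral_re hi
  simp only [RCLike.re_eq_complex_re, Complex.exp_ofReal_mul_I_re] at h3
  rw [h3, h2]
  norm_cast

lemma integral_sin_inner_mul_sin_inner_stdGaussian (x y : E) :
    ∫ g, Real.sin (inner ℝ g x) * Real.sin (inner ℝ g y) ∂(stdGaussian E)
      = Real.exp (-(‖x‖ ^ 2 + ‖y‖ ^ 2) / 2) * Real.sinh (inner ℝ x y) := by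
  have hi : ∀ t : E, Integrable (fun g : E => Real.cos (inner ℝ g t)) (stdGaussian E) := fun t =>
    Integrable.of_bound (C := 1) (by fun_prop) (.of_forall fun g => Real.abs_cos_le_one _)
  have h : ∀ g : E, Real.sin (inner ℝ g x) * Real.sin (inner ℝ g y)
      = (Real.cos (inner ℝ g (x - y)) - Real.cos (inner ℝ g (x + y))) / 2 := fun g => by
    rw [inner_sub_right, inner_add_right, Real.cos_sub, Real.cos_add]; ring
  simp_rw [h]
  rw [integral_div, integral_sub (hi _) (hi _), integral_cos_inner_stdGaussian,
    integral_cos_inner_stdGaussian, norm_sub_sq_real, norm_add_sq_real, Real.sinh_eq,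
    mul_div_assoc', mul_sub, ← Real.exp_add, ← Real.exp_add]
  congr 3 <;> ring_nf

lemma sinh_le_two_mul {t : ℝ} (h0 : 0 ≤ t) (h1 : t ≤ 1) : Real.sinh t ≤ 2 * t := by
  have h2 := Real.abs_exp_sub_one_sub_id_le (x := t) (by rwa [abs_of_nonneg h0])
  have h3 := Real.add_one_le_exp (-t)
  rw [Real.sinh_eq]
  nlinarith [abs_le.1 h2]

lemma exp_mul_sinh_le {s t p q : ℝ} (hs0 : 0 ≤ s) (hs : s ≤ 1) (ht1 : t ≤ 1)
    (htpq : t ≤ p - q) (hp : 0 ≤ p) (hq : 0 ≤ q) :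
    Real.exp (-s) * Real.sinh t ≤ 2 * p - q / 3 := by
  rcases le_total 0 t with ht | ht
  · have h1 := sinh_le_two_mul ht ht1
    have h2 : Real.exp (-s) ≤ 1 := Real.exp_le_one_iff.2 (by linarith)
    have h3 : 0 ≤ Real.sinh t := Real.sinh_nonneg_iff.2 ht
    nlinarith
  · have h1 : Real.sinh t ≤ t := Real.sinh_le_self_iff.2 ht
    have h2 : (1 : ℝ) / 3 ≤ Real.exp (-s) := by
      have h := Real.exp_one_lt_d9
      rw [Real.exp_neg, ← one_div]
      apply one_div_le_one_div_of_le (Real.exp_pos _)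
      have := Real.exp_le_exp.2 hs
      linarith
    have h3 : Real.exp (-s) ≤ 1 := Real.exp_le_one_iff.2 (by linarith)
    nlinarith

end Gaussian

open Classical in
lemma two_mul_edgeCount [Fintype V] (G : SimpleGraph V) :
    (2 * edgeCount G : ℝ) = ∑ u, ∑ _v ∈ G.neighborFinset u, (1 : ℝ) := by
  have := G.sum_degrees_eq_twice_card_edges
  rw [edgeCount, Nat.card_eq_fintype_card, ← SimpleGraph.edgeFinset_card]
  simp only [sum_const, nsmul_eq_mul, mul_one, SimpleGraph.card_neighborFinset_eq_degree]
  exact_mod_cast this.symm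

open Classical in
/-- Random rounding with the sine of Gaussian projections: vectors in the unit ball whose inner
products along edges are mostly negative give a large surplus. -/
lemma sum_le_four_mul_surplus [Fintype V] (G : SimpleGraph V) (f : V → V → ℝ)
    (hf : ∀ u, ∑ w, f u w ^ 2 ≤ 1) (P N : V → V → ℝ)
    (hP : ∀ u v, G.Adj u v → 0 ≤ P u v) (hN : ∀ u v, G.Adj u v → 0 ≤ N u v)
    (hPN : ∀ u v, G.Adj u v → ∑ w, f u w * f v w ≤ P u v - N u v) :
    ∑ u, ∑ v ∈ G.neighborFinset u, (N u v / 3 - 2 * P u v) ≤ 4 * surplus G := by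
  let Q : (V → ℝ) → ℝ := fun y => ∑ u, ∑ v ∈ G.neighborFinset u, y u * y v
  have hQaff : ∀ y v, ∃ a b : ℝ, ∀ t, Q (Function.update y v t) = a + b * t := by
    intro y v
    have : ∀ u w, ∃ a b : ℝ, ∀ t, G.Adj u w →
        Function.update y v t u * Function.update y v t w = a + b * t := by
      intro u w
      by_cases h : G.Adj u w
      · by_cases hu : u = v
        · subst hu
          exact ⟨0, y w, fun t _ => by simp [h.ne']; ring⟩
        · by_cases hw : w = v
          · subst hw
            exact ⟨0, y u, fun t _ => by simp [h.ne]⟩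
          · exact ⟨y u * y w, 0, fun t _ => by simp [hu, hw]⟩
      · exact ⟨0, 0, fun t h' => absurd h' h⟩
    choose a b hab using this
    refine ⟨∑ u, ∑ w ∈ G.neighborFinset u, a u w, ∑ u, ∑ w ∈ G.neighborFinset u, b u w,
      fun t => ?_⟩
    simp only [Q, sum_mul, ← sum_add_distrib]
    exact sum_congr rfl fun u _ => sum_congr rfl fun w hw =>
      hab u w t (by simpa using hw)
  have hround : ∀ y : V → ℝ, (∀ v, |y v| ≤ 1) → -(4 * surplus G) ≤ Q y := by
    intro y hy
    obtain ⟨σ, hσ, hle⟩ := exists_sign_le_of_multiaffine Q hQaff y hy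
    refine le_trans ?_ hle
    have hcut : ∀ τ : V → ℝ, ∑ u, ∑ v ∈ G.neighborFinset u,
        (if τ u = 1 ∧ τ v ≠ 1 then (1 : ℝ) else 0) ≤ maxCut G := by
      intro τ
      have hS : cutSize G (univ.filter fun v => τ v = 1) ≤ maxCut G :=
        Finset.le_sup (f := cutSize G) (mem_powerset.2 (subset_univ _))
      refine le_trans (le_of_eq ?_) (Nat.cast_le.2 hS)
      rw [cutSize, Nat.card_eq_fintype_card, Fintype.card_subtype, card_filter,
        ← univ_product_univ, sum_product]
      push_cast
      refine sum_congr rfl fun u _ => ?_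
      rw [SimpleGraph.neighborFinset_eq_filter, sum_filter]
      refine sum_congr rfl fun v _ => ?_
      by_cases h : G.Adj u v <;> simp [h]
    have hQ : Q σ = 2 * edgeCount G
        - 2 * (∑ u, ∑ v ∈ G.neighborFinset u, (if σ u = 1 ∧ σ v ≠ 1 then (1 : ℝ) else 0))
        - 2 * (∑ u, ∑ v ∈ G.neighborFinset u,
            (if -σ u = 1 ∧ -σ v ≠ 1 then (1 : ℝ) else 0)) := by
      simp only [two_mul_edgeCount, Q, mul_sum, ← sum_sub_distrib]
      refine sum_congr rfl fun u _ => sum_congr rfl fun v _ => ?_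
      rcases hσ u with hu | hu <;> rcases hσ v with hv | hv <;> rw [hu, hv] <;> norm_num
    have h1 := hcut σ
    have h2 := hcut fun v => -σ v
    rw [hQ, surplus]
    linarith
  let x : V → EuclideanSpace ℝ V := fun u => WithLp.toLp 2 (f u)
  have hin : ∀ u v, inner ℝ (x u) (x v) = ∑ w, f u w * f v w := fun u v => by
    simp [x, PiLp.inner_apply, mul_comm]
  have hnorm : ∀ u, ‖x u‖ ^ 2 ≤ 1 := fun u => by
    rw [← real_inner_self_eq_norm_sq, hin]
    simpa [sq] using hf u
  have hnorm1 : ∀ u, ‖x u‖ ≤ 1 := fun u => by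
    nlinarith [hnorm u, norm_nonneg (x u)]
  have hint : ∀ u v, Integrable (fun g : EuclideanSpace ℝ V =>
      Real.sin (inner ℝ g (x u)) * Real.sin (inner ℝ g (x v))) (stdGaussian _) := fun u v => by
    refine Integrable.of_bound (C := 1) (by fun_prop) (.of_forall fun g => ?_)
    rw [norm_mul]
    exact mul_le_one₀ (Real.abs_sin_le_one _) (norm_nonneg _) (Real.abs_sin_le_one _)
  have hE : ∫ g : EuclideanSpace ℝ V, Q (fun v => Real.sin (inner ℝ g (x v))) ∂(stdGaussian _)
      ≤ ∑ u, ∑ v ∈ G.neighborFinset u, (2 * P u v - N u v / 3) := by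
    simp only [Q]
    rw [integral_finsetSum _ fun u _ => integrable_finsetSum _ fun v _ => hint u v]
    refine sum_le_sum fun u _ => ?_
    rw [integral_finsetSum _ fun v _ => hint u v]
    refine sum_le_sum fun v hv => ?_
    have hadj : G.Adj u v := by simpa using hv
    rw [integral_sin_inner_mul_sin_inner_stdGaussian, neg_div]
    refine exp_mul_sinh_le (by positivity) (by linarith [hnorm u, hnorm v]) ?_
      ((hin u v).trans_le (hPN u v hadj)) (hP u v hadj) (hN u v hadj)
    exact (real_inner_le_norm _ _).trans
      (mul_le_one₀ (hnorm1 u) (norm_nonneg _) (hnorm1 v))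
  have hlow : -(4 * surplus G) ≤
      ∫ g : EuclideanSpace ℝ V, Q (fun v => Real.sin (inner ℝ g (x v))) ∂(stdGaussian _) := by
    have : ∫ _ : EuclideanSpace ℝ V, -(4 * surplus G) ∂(stdGaussian (EuclideanSpace ℝ V))
        = -(4 * surplus G) := by simp
    rw [← this]
    refine integral_mono (integrable_const _) ?_ fun g => hround _ fun v => Real.abs_sin_le_one _
    exact integrable_finsetSum _ fun u _ => integrable_finsetSum _ fun v _ => hint u v
  have hneg : ∑ u, ∑ v ∈ G.neighborFinset u, (N u v / 3 - 2 * P u v)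
      = -∑ u, ∑ v ∈ G.neighborFinset u, (2 * P u v - N u v / 3) := by
    simp only [← sum_neg_distrib, neg_sub]
  linarith

section PentagonFree

open Classical

lemma CycleFree.not_pentagon {G : SimpleGraph V} (h5 : CycleFree G 5) {a b c d e : V}
    (hab : G.Adj a b) (hbc : G.Adj b c) (hcd : G.Adj c d) (hde : G.Adj d e) (hea : G.Adj e a)
    (hac : a ≠ c) (had : a ≠ d) (hbd : b ≠ d) (hbe : b ≠ e) (hce : c ≠ e) : False := by
  let w : G.Walk a a := .cons hab (.cons hbc (.cons hcd (.cons hde (.cons hea .nil))))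
  refine h5 w ?_ rfl
  rw [SimpleGraph.Walk.cons_isCycle_iff]
  have := hab.ne; have := hbc.ne; have := hcd.ne; have := hde.ne; have := hea.ne
  constructor
  · simp [SimpleGraph.Walk.isPath_def]
    grind
  · simp
    grind

variable [Fintype V] {G : SimpleGraph V} {d : ℕ}

/-- The vertices reached from `u` by a walk of length two that are not neighbours of `u`; this
includes `u` itself unless `u` is isolated. -/
noncomputable def secondNeighbors (G : SimpleGraph V) (u : V) : Finset V :=
  univ.filter fun w => ¬ G.Adj u w ∧ ∃ a, G.Adj u a ∧ G.Adj a w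

lemma mem_secondNeighbors {u w : V} :
    w ∈ secondNeighbors G u ↔ ¬ G.Adj u w ∧ ∃ a, G.Adj u a ∧ G.Adj a w := by
  simp [secondNeighbors]

/-- The number of common neighbours. -/
noncomputable def codeg (G : SimpleGraph V) (u v : V) : ℕ :=
  #(G.neighborFinset u ∩ G.neighborFinset v)

lemma CycleFree.codeg_le_two_or (h5 : CycleFree G 5) {u v w : V} (huv : G.Adj u v)
    (huw : G.Adj u w) (hvw : G.Adj v w) : codeg G u v ≤ 2 ∨ codeg G u w ≤ 2 := by
  by_contra! h
  obtain ⟨a, ha, haw⟩ := exists_mem_notMem_of_card_lt_card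
    (s := {w}) (t := G.neighborFinset u ∩ G.neighborFinset v) (by
      rw [card_singleton]; exact lt_trans (by norm_num) h.1)
  obtain ⟨b, hb, hbw⟩ := exists_mem_notMem_of_card_lt_card
    (s := {v, a}) (t := G.neighborFinset u ∩ G.neighborFinset w) (card_le_two.trans_lt h.2)
  simp only [mem_inter, SimpleGraph.mem_neighborFinset, mem_singleton, mem_insert,
    not_or] at ha haw hb hbw
  exact h5.not_pentagon ha.1 ha.2.symm hvw hb.2 hb.1.symm huv.ne huw.ne haw
    (Ne.symm hbw.2) (Ne.symm hbw.1)

lemma CycleFree.sum_codeg_le (h5 : CycleFree G 5) (u : V) :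
    ∑ v ∈ G.neighborFinset u, codeg G u v ≤ 4 * #(G.neighborFinset u) := by
  have hcodeg : ∀ v, codeg G u v = ∑ w ∈ G.neighborFinset u, if G.Adj v w then 1 else 0 := by
    intro v
    rw [codeg, ← card_filter]
    congr 1
    ext w
    simp
  let A : V → V → ℕ := fun v w => if G.Adj v w ∧ codeg G u v ≤ 2 then 1 else 0
  have hA : ∑ v ∈ G.neighborFinset u, ∑ w ∈ G.neighborFinset u, A v w
      ≤ ∑ v ∈ G.neighborFinset u, 2 := by
    refine sum_le_sum fun v _ => ?_
    by_cases h : codeg G u v ≤ 2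
    · simp [A, h, ← hcodeg]
    · simp [A, h]
  calc ∑ v ∈ G.neighborFinset u, codeg G u v
      ≤ ∑ v ∈ G.neighborFinset u, ∑ w ∈ G.neighborFinset u, (A v w + A w v) := by
        refine sum_le_sum fun v hv => ?_
        rw [hcodeg]
        refine sum_le_sum fun w hw => ?_
        rw [SimpleGraph.mem_neighborFinset] at hv hw
        by_cases hvw : G.Adj v w
        · rcases h5.codeg_le_two_or hv hw hvw with h | h
          · simp [A, hvw, h]
          · simp [A, hvw, hvw.symm, h]
        · simp [hvw]
    _ = 2 * ∑ v ∈ G.neighborFinset u, ∑ w ∈ G.neighborFinset u, A v w := by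
        simp only [sum_add_distrib]
        rw [sum_comm (f := fun v w => A w v)]
        ring
    _ ≤ 4 * #(G.neighborFinset u) := by
        rw [sum_const, smul_eq_mul] at hA
        linarith

lemma CycleFree.card_secondNeighbors_inter_le (h5 : CycleFree G 5)
    (hreg : ∀ v, #(G.neighborFinset v) = d) {u v : V} (huv : G.Adj u v) :
    #(secondNeighbors G u ∩ secondNeighbors G v) ≤ codeg G u v * d := by
  refine le_trans (card_le_card ?_) (card_biUnion_le_card_mul
    (G.neighborFinset u ∩ G.neighborFinset v) (G.neighborFinset ·) d fun a _ => (hreg a).le)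
  intro w hw
  simp only [mem_inter, mem_secondNeighbors] at hw
  obtain ⟨⟨huw, a, hua, haw⟩, hvw, b, hvb, hbw⟩ := hw
  have hab : a = b := by
    by_contra hab
    refine h5.not_pentagon hua haw hbw.symm hvb.symm huv.symm ?_ ?_ hab ?_ ?_
    · rintro rfl; exact hvw huv.symm
    · rintro rfl; exact huw hbw
    · rintro rfl; exact hvw haw
    · rintro rfl; exact huw huv
  subst hab
  simp only [mem_biUnion, mem_inter, SimpleGraph.mem_neighborFinset]
  exact ⟨a, ⟨hua, hvb⟩, haw⟩

lemma card_secondNeighbors_le (hreg : ∀ v, #(G.neighborFinset v) = d) (u : V) :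
    #(secondNeighbors G u) ≤ d * d := by
  refine le_trans (card_le_card ?_) ((card_biUnion_le_card_mul
    (G.neighborFinset u) (G.neighborFinset ·) d fun a _ => (hreg a).le).trans_eq (by rw [hreg]))
  intro w hw
  simpa using (mem_secondNeighbors.1 hw).2

lemma card_le_card_secondNeighbors_inter_add (hreg : ∀ v, #(G.neighborFinset v) = d) {u v : V}
    (huv : G.Adj u v) :
    d ≤ #(secondNeighbors G u ∩ G.neighborFinset v) + codeg G u v := by
  rw [← hreg v, codeg]
  refine (card_le_card fun w hw => ?_).trans (card_union_le _ _)
  rw [SimpleGraph.mem_neighborFinset] at hw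
  simp only [mem_union, mem_inter, mem_secondNeighbors, SimpleGraph.mem_neighborFinset]
  by_cases h : G.Adj u w
  · exact Or.inr ⟨h, hw⟩
  · exact Or.inl ⟨⟨h, v, huv, hw⟩, hw⟩

lemma one_le_card_secondNeighbors_inter {u v : V} (huv : G.Adj u v) :
    1 ≤ #(secondNeighbors G u ∩ G.neighborFinset v) := by
  refine card_pos.2 ⟨u, ?_⟩
  simp only [mem_inter, mem_secondNeighbors, SimpleGraph.mem_neighborFinset]
  exact ⟨⟨G.irrefl, v, huv, huv.symm⟩, huv.symm⟩

lemma CycleFree.sq_le_five_mul_sum (h5 : CycleFree G 5)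
    (hreg : ∀ v, #(G.neighborFinset v) = d) (u : V) :
    d * d ≤ 5 * ∑ v ∈ G.neighborFinset u, #(secondNeighbors G u ∩ G.neighborFinset v) := by
  have h1 : ∑ v ∈ G.neighborFinset u, d ≤ ∑ v ∈ G.neighborFinset u,
      (#(secondNeighbors G u ∩ G.neighborFinset v) + codeg G u v) :=
    sum_le_sum fun v hv => card_le_card_secondNeighbors_inter_add hreg (by simpa using hv)
  have h2 : ∑ v ∈ G.neighborFinset u, 1 ≤ ∑ v ∈ G.neighborFinset u,
      #(secondNeighbors G u ∩ G.neighborFinset v) :=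
    sum_le_sum fun v hv => one_le_card_secondNeighbors_inter (by simpa using hv)
  have h3 := h5.sum_codeg_le u
  rw [sum_add_distrib] at h1
  simp only [sum_const, smul_eq_mul, hreg] at h1 h2 h3
  linarith

lemma CycleFree.degree_le_five_mul_card (h5 : CycleFree G 5)
    (hreg : ∀ v, #(G.neighborFinset v) = d) (u : V) :
    d ≤ 5 * #(secondNeighbors G u) := by
  rcases Nat.eq_zero_or_pos d with rfl | hd
  · simp
  have h1 := h5.sq_le_five_mul_sum hreg u
  have h2 : ∑ v ∈ G.neighborFinset u, #(secondNeighbors G u ∩ G.neighborFinset v)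
      ≤ ∑ v ∈ G.neighborFinset u, #(secondNeighbors G u) :=
    sum_le_sum fun v _ => card_le_card inter_subset_left
  rw [sum_const, smul_eq_mul, hreg] at h2
  refine Nat.le_of_mul_le_mul_left ?_ hd
  linarith

lemma sum_sum_neighborFinset_comm (g : V → V → ℝ) :
    ∑ u, ∑ v ∈ G.neighborFinset u, g u v = ∑ u, ∑ v ∈ G.neighborFinset u, g v u := by
  simp only [SimpleGraph.neighborFinset_eq_filter, sum_filter]
  rw [sum_comm]
  simp only [G.adj_comm]

/-- `√(d / s)`, where `s` is the size of the second neighbourhood of `u`. -/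
noncomputable def expansionRatio (G : SimpleGraph V) (d : ℕ) (u : V) : ℝ :=
  √d / √(#(secondNeighbors G u))

lemma CycleFree.card_secondNeighbors_pos (h5 : CycleFree G 5)
    (hreg : ∀ v, #(G.neighborFinset v) = d) (hd : 0 < d) (u : V) :
    0 < (#(secondNeighbors G u) : ℝ) := by
  have := h5.degree_le_five_mul_card hreg u
  exact_mod_cast (by omega : 0 < #(secondNeighbors G u))

lemma CycleFree.expansionRatio_le (h5 : CycleFree G 5)
    (hreg : ∀ v, #(G.neighborFinset v) = d) (hd : 0 < d) (u : V) :
    expansionRatio G d u ≤ 9 / 4 := by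
  have hs := h5.card_secondNeighbors_pos hreg hd u
  have h : (d : ℝ) ≤ 5 * #(secondNeighbors G u) := by
    exact_mod_cast h5.degree_le_five_mul_card hreg u
  rw [expansionRatio, ← Real.sqrt_div (Nat.cast_nonneg d)]
  refine Real.sqrt_le_iff.2 ⟨by norm_num, ?_⟩
  rw [div_le_iff₀ hs]
  linarith

lemma CycleFree.one_le_sqrt_mul_expansionRatio (h5 : CycleFree G 5)
    (hreg : ∀ v, #(G.neighborFinset v) = d) (hd : 0 < d) (u : V) :
    1 ≤ √d * expansionRatio G d u := by
  have hs := h5.card_secondNeighbors_pos hreg hd u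
  have h : (#(secondNeighbors G u) : ℝ) ≤ d * d := by
    exact_mod_cast card_secondNeighbors_le hreg u
  rw [expansionRatio, mul_div_assoc', one_le_div (Real.sqrt_pos.2 hs),
    Real.mul_self_sqrt (Nat.cast_nonneg d)]
  exact Real.sqrt_le_iff.2 ⟨Nat.cast_nonneg d, by rwa [sq]⟩

/-- The normalised overlaps of the second neighbourhoods of adjacent vertices are small in total. -/
lemma CycleFree.sum_overlap_le (h5 : CycleFree G 5)
    (hreg : ∀ v, #(G.neighborFinset v) = d) (hd : 0 < d) :
    ∑ u, ∑ v ∈ G.neighborFinset u, (#(secondNeighbors G u ∩ secondNeighbors G v) : ℝ)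
        / (√(#(secondNeighbors G u)) * √(#(secondNeighbors G v)))
      ≤ 9 * d * ∑ u, expansionRatio G d u := by
  have hd' : (0 : ℝ) < d := by exact_mod_cast hd
  let r := expansionRatio G d
  have hr0 : ∀ u, 0 ≤ r u := fun u => by simp only [r, expansionRatio]; positivity
  have hcomm : ∀ u v, codeg G u v = codeg G v u := fun u v => by rw [codeg, inter_comm, codeg]
  calc _ ≤ ∑ u, ∑ v ∈ G.neighborFinset u,
          ((codeg G u v : ℝ) * r u ^ 2 / 2 + (codeg G v u : ℝ) * r v ^ 2 / 2) := by
        refine sum_le_sum fun u _ => sum_le_sum fun v hv => ?_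
        have hsu := Real.sqrt_pos.2 (h5.card_secondNeighbors_pos hreg hd u)
        have hsv := Real.sqrt_pos.2 (h5.card_secondNeighbors_pos hreg hd v)
        have h : (#(secondNeighbors G u ∩ secondNeighbors G v) : ℝ) ≤ codeg G u v * d := by
          exact_mod_cast h5.card_secondNeighbors_inter_le hreg (by simpa using hv)
        have hruv : (d : ℝ) / (√(#(secondNeighbors G u)) * √(#(secondNeighbors G v)))
            = r u * r v := by
          simp only [r, expansionRatio]
          rw [div_mul_div_comm, Real.mul_self_sqrt hd'.le]
        calc _ ≤ (codeg G u v : ℝ) * d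
              / (√(#(secondNeighbors G u)) * √(#(secondNeighbors G v))) := by gcongr
          _ = codeg G u v * (r u * r v) := by rw [mul_div_assoc, hruv]
          _ ≤ codeg G u v * ((r u ^ 2 + r v ^ 2) / 2) := by
            gcongr
            nlinarith [sq_nonneg (r u - r v)]
          _ = _ := by rw [hcomm v u]; ring
    _ = ∑ u, ∑ v ∈ G.neighborFinset u, (codeg G u v : ℝ) * r u ^ 2 := by
        simp only [sum_add_distrib]
        rw [← sum_sum_neighborFinset_comm fun u v => (codeg G u v : ℝ) * r u ^ 2 / 2,
          ← sum_add_distrib]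
        refine sum_congr rfl fun u _ => ?_
        rw [← sum_add_distrib]
        exact sum_congr rfl fun v _ => by ring
    _ ≤ ∑ u, 9 * d * r u := by
        refine sum_le_sum fun u _ => ?_
        have h1 : (∑ v ∈ G.neighborFinset u, (codeg G u v : ℝ)) ≤ 4 * d := by
          have := h5.sum_codeg_le u
          rw [hreg] at this
          exact_mod_cast this
        have h2 : r u ^ 2 ≤ 9 / 4 * r u := by
          rw [sq]
          exact mul_le_mul_of_nonneg_right (h5.expansionRatio_le hreg hd u) (hr0 u)
        rw [← sum_mul]
        calc _ ≤ 4 * d * (9 / 4 * r u) := by gcongr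
          _ = _ := by ring
    _ = _ := by rw [mul_sum]

/-- The surplus bound that comes from local expansion. -/
lemma CycleFree.sum_expansionRatio_le_surplus (h5 : CycleFree G 5)
    (hreg : ∀ v, #(G.neighborFinset v) = d) (hd : 0 < d) :
    d * ∑ u, expansionRatio G d u ≤ 9331200 * surplus G := by
  have hd' : (0 : ℝ) < d := by exact_mod_cast hd
  have hd1 : (1 : ℝ) ≤ √d := Real.one_le_sqrt.2 (by exact_mod_cast hd)
  have hdd : √(d : ℝ) * √d = d := Real.mul_self_sqrt hd'.le
  let t : V → ℝ := fun u => √(#(secondNeighbors G u))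
  have ht : ∀ u, 0 < t u := fun u => Real.sqrt_pos.2 (h5.card_secondNeighbors_pos hreg hd u)
  have htt : ∀ u, (#(secondNeighbors G u) : ℝ) = t u * t u := fun u =>
    (Real.mul_self_sqrt (Nat.cast_nonneg _)).symm
  obtain ⟨β, hβ⟩ : ∃ β : ℝ, β = 1 / 12 := ⟨_, rfl⟩
  obtain ⟨α, hα⟩ : ∃ α : ℝ, α = 1 / 3240 := ⟨_, rfl⟩
  have hα0 : 0 < α := by rw [hα]; norm_num
  have hβ0 : 0 < β := by rw [hβ]; norm_num
  let I : Finset V → V → ℝ := fun S w => if w ∈ S then 1 else 0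
  have hI : ∀ S T, ∑ w, I S w * I T w = #(S ∩ T) := fun S T => by
    rw [inter_comm]
    simp [I, ← ite_and, ← mem_inter]
  let f : V → V → ℝ := fun u w => 1 / 2 * I {u} w + α / (2 * t u) * I (secondNeighbors G u) w
    - β / (2 * √d) * I (G.neighborFinset u) w
  have hexp : ∀ u v, ∑ w, f u w * f v w =
      1 / 4 * #({u} ∩ ({v} : Finset V))
      + 1 / 2 * (α / (2 * t v)) * #({u} ∩ secondNeighbors G v)
      + 1 / 2 * (α / (2 * t u)) * #(secondNeighbors G u ∩ {v})
      - 1 / 2 * (β / (2 * √d)) * #({u} ∩ G.neighborFinset v)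
      - 1 / 2 * (β / (2 * √d)) * #(G.neighborFinset u ∩ {v})
      + (α / (2 * t u)) * (α / (2 * t v)) * #(secondNeighbors G u ∩ secondNeighbors G v)
      - (α / (2 * t u)) * (β / (2 * √d)) * #(secondNeighbors G u ∩ G.neighborFinset v)
      - (α / (2 * t v)) * (β / (2 * √d)) * #(G.neighborFinset u ∩ secondNeighbors G v)
      + (β / (2 * √d)) * (β / (2 * √d)) * #(G.neighborFinset u ∩ G.neighborFinset v) := by
    intro u v
    simp only [← hI, mul_sum, ← sum_add_distrib, ← sum_sub_distrib]
    exact sum_congr rfl fun w _ => by simp only [f]; ring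
  let P : V → V → ℝ := fun u v => β ^ 2 / (4 * d) * codeg G u v
    + α ^ 2 / 4 * (#(secondNeighbors G u ∩ secondNeighbors G v) / (t u * t v))
  let N₁ : V → V → ℝ := fun u v => #(secondNeighbors G u ∩ G.neighborFinset v) / (t u * √d)
  let N : V → V → ℝ := fun u v => β / (2 * √d) + α * β / 4 * (N₁ u v + N₁ v u)
  have hmain := sum_le_four_mul_surplus G f ?_ P N ?_ ?_ ?_
  · have hsplit : ∑ u, ∑ v ∈ G.neighborFinset u, (N u v / 3 - 2 * P u v)
        = ∑ u : V, ∑ v ∈ G.neighborFinset u, β / (6 * √d)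
          + α * β / 6 * (∑ u, ∑ v ∈ G.neighborFinset u, N₁ u v)
          - β ^ 2 / (2 * d) * (∑ u, ∑ v ∈ G.neighborFinset u, (codeg G u v : ℝ))
          - α ^ 2 / 2 * (∑ u, ∑ v ∈ G.neighborFinset u,
              #(secondNeighbors G u ∩ secondNeighbors G v) / (t u * t v)) := by
      have hN₁ : α * β / 6 * (∑ u, ∑ v ∈ G.neighborFinset u, N₁ u v)
          = α * β / 12 * (∑ u, ∑ v ∈ G.neighborFinset u, N₁ u v)
            + α * β / 12 * (∑ u, ∑ v ∈ G.neighborFinset u, N₁ v u) := by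
        rw [← sum_sum_neighborFinset_comm N₁]; ring
      rw [hN₁]
      simp only [mul_sum, ← sum_add_distrib, ← sum_sub_distrib]
      exact sum_congr rfl fun u _ => sum_congr rfl fun v _ => by simp only [N, P]; ring
    have h1 : ∑ u : V, ∑ v ∈ G.neighborFinset u, β / (6 * √d)
        = β / 6 * (Fintype.card V * √d) := by
      simp only [sum_const, hreg, card_univ, nsmul_eq_mul]
      field_simp
      linear_combination (-(Fintype.card V : ℝ)) * hdd
    have h2 : d / 5 * ∑ u, expansionRatio G d u ≤ ∑ u, ∑ v ∈ G.neighborFinset u, N₁ u v := by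
      rw [mul_sum]
      refine sum_le_sum fun u _ => ?_
      have h : (d : ℝ) * d ≤ 5 * ∑ v ∈ G.neighborFinset u,
          (#(secondNeighbors G u ∩ G.neighborFinset v) : ℝ) := by
        exact_mod_cast h5.sq_le_five_mul_sum hreg u
      have htu := ht u
      rw [← sum_div, le_div_iff₀ (mul_pos htu (by positivity))]
      have : d / 5 * expansionRatio G d u * (t u * √d) = d * d / 5 := by
        change d / 5 * (√d / t u) * (t u * √d) = d * d / 5
        field_simp
        rw [sq, hdd]
      rw [this]
      linarith
    have h3 : ∑ u, ∑ v ∈ G.neighborFinset u, (codeg G u v : ℝ)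
        ≤ 4 * d * Fintype.card V := by
      have : ∀ u ∈ (univ : Finset V), ∑ v ∈ G.neighborFinset u, (codeg G u v : ℝ) ≤ 4 * d := by
        intro u _
        have := h5.sum_codeg_le u
        rw [hreg] at this
        exact_mod_cast this
      refine (sum_le_sum this).trans_eq ?_
      simp [mul_comm]
    have h3' : β ^ 2 / (2 * d) * (∑ u, ∑ v ∈ G.neighborFinset u, (codeg G u v : ℝ))
        ≤ 2 * β ^ 2 * Fintype.card V := by
      calc _ ≤ β ^ 2 / (2 * d) * (4 * d * Fintype.card V) := by gcongr
        _ = _ := by field_simp; ring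
    have h4 := h5.sum_overlap_le hreg hd
    have h5' : (Fintype.card V : ℝ) ≤ Fintype.card V * √d :=
      le_mul_of_one_le_right (Nat.cast_nonneg _) hd1
    rw [hsplit, h1] at hmain
    simp only [t] at hmain h2
    rw [hβ, hα] at hmain
    rw [hβ] at h3'
    linarith
  · intro u
    have h : ∀ w, f u w ^ 2 ≤ 3 * (1 / 4 * (I {u} w * I {u} w)
        + α ^ 2 / (4 * (t u * t u)) * (I (secondNeighbors G u) w * I (secondNeighbors G u) w)
        + β ^ 2 / (4 * d) * (I (G.neighborFinset u) w * I (G.neighborFinset u) w)) := by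
      intro w
      have hrw : β ^ 2 / (4 * (d : ℝ)) = (β / (2 * √d)) ^ 2 := by
        rw [div_pow, mul_pow, sq (√(d : ℝ)), hdd]; norm_num
      have hrw2 : α ^ 2 / (4 * (t u * t u)) = (α / (2 * t u)) ^ 2 := by
        rw [div_pow, mul_pow, sq (t u)]; norm_num
      rw [hrw, hrw2]
      have key : ∀ x y z : ℝ, (x + y - z) ^ 2 ≤ 3 * (x ^ 2 + y ^ 2 + z ^ 2) := fun x y z => by
        nlinarith [sq_nonneg (x - y), sq_nonneg (x + z), sq_nonneg (y + z)]
      exact (key _ _ _).trans_eq (by ring)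
    refine (sum_le_sum fun w _ => h w).trans ?_
    simp only [← mul_sum, sum_add_distrib, hI, inter_self, htt, hreg, card_singleton]
    have htu := (ht u).ne'
    have : α ^ 2 / (4 * (t u * t u)) * (t u * t u) = α ^ 2 / 4 := by field_simp
    rw [this]
    have : β ^ 2 / (4 * (d : ℝ)) * d = β ^ 2 / 4 := by field_simp
    rw [this, hα, hβ]
    norm_num
  · intro u v _
    exact add_nonneg (by positivity) (mul_nonneg (by positivity)
      (div_nonneg (Nat.cast_nonneg _) (mul_nonneg (ht u).le (ht v).le)))
  · intro u v _
    have hN₁ : ∀ u v, 0 ≤ N₁ u v := fun u v =>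
      div_nonneg (Nat.cast_nonneg _) (mul_nonneg (ht u).le (Real.sqrt_nonneg _))
    have := hN₁ u v
    have := hN₁ v u
    exact add_nonneg (by positivity) (mul_nonneg (by positivity) (by linarith))
  · intro u v huv
    have htu := (ht u).ne'
    have htv := (ht v).ne'
    have e1 : #({u} ∩ ({v} : Finset V)) = 0 := by simp [huv.ne]
    have e2 : #({u} ∩ secondNeighbors G v) = 0 := by simp [mem_secondNeighbors, huv.symm]
    have e3 : #(secondNeighbors G u ∩ {v}) = 0 := by simp [mem_secondNeighbors, huv]
    have e4 : #({u} ∩ G.neighborFinset v) = 1 := by simp [huv.symm]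
    have e5 : #(G.neighborFinset u ∩ {v}) = 1 := by simp [huv]
    rw [hexp, e1, e2, e3, e4, e5, inter_comm (G.neighborFinset u) (secondNeighbors G v)]
    refine le_of_eq ?_
    simp only [P, N, N₁, codeg]
    have : β ^ 2 / (4 * (d : ℝ)) = β ^ 2 / (4 * (√d * √d)) := by rw [hdd]
    rw [this]
    field_simp
    push_cast
    ring

/-- The surplus bound that comes from the second neighbourhoods being dense. -/
lemma CycleFree.sum_sqrt_mul_sqrt_le_surplus (h5 : CycleFree G 5)
    (hreg : ∀ v, #(G.neighborFinset v) = d) (hd : 0 < d) :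
    ∑ u, ∑ v ∈ G.neighborFinset u,
        √(#(secondNeighbors G u)) * √(#(secondNeighbors G v)) / Fintype.card V
      ≤ 12 * surplus G + 54 * (d * ∑ u, expansionRatio G d u) := by
  rcases isEmpty_or_nonempty V with hV | hV
  · have := h5.sum_expansionRatio_le_surplus hreg hd
    simp only [univ_eq_empty, sum_empty, mul_zero] at this ⊢
    linarith
  have hn : (0 : ℝ) < Fintype.card V := by exact_mod_cast Fintype.card_pos
  let t : V → ℝ := fun u => √(#(secondNeighbors G u))
  have ht : ∀ u, 0 < t u := fun u => Real.sqrt_pos.2 (h5.card_secondNeighbors_pos hreg hd u)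
  have htt : ∀ u, (#(secondNeighbors G u) : ℝ) = t u * t u := fun u =>
    (Real.mul_self_sqrt (Nat.cast_nonneg _)).symm
  let I : Finset V → V → ℝ := fun S w => if w ∈ S then 1 else 0
  have hI : ∀ S T, ∑ w, I S w * I T w = #(S ∩ T) := fun S T => by
    rw [inter_comm]
    simp [I, ← ite_and, ← mem_inter]
  let f : V → V → ℝ := fun u w =>
    1 / t u * I (secondNeighbors G u) w - t u / Fintype.card V * I univ w
  let P : V → V → ℝ := fun u v => #(secondNeighbors G u ∩ secondNeighbors G v) / (t u * t v)
  let N : V → V → ℝ := fun u v => t u * t v / Fintype.card V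
  have hexp : ∀ u v, ∑ w, f u w * f v w = P u v - N u v := by
    intro u v
    have htu := (ht u).ne'
    have htv := (ht v).ne'
    calc _ = 1 / t u * (1 / t v) * #(secondNeighbors G u ∩ secondNeighbors G v)
          - 1 / t u * (t v / Fintype.card V) * #(secondNeighbors G u ∩ univ)
          - 1 / t v * (t u / Fintype.card V) * #(univ ∩ secondNeighbors G v)
          + t u / Fintype.card V * (t v / Fintype.card V) * #(univ ∩ (univ : Finset V)) := by
          simp only [← hI, mul_sum, ← sum_add_distrib, ← sum_sub_distrib]
          exact sum_congr rfl fun w _ => by simp only [f]; ring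
      _ = _ := by
          rw [inter_univ, univ_inter, univ_inter, card_univ, htt, htt]
          simp only [P, N]
          field_simp
          ring
  have hmain := sum_le_four_mul_surplus G f ?_ P N ?_ ?_ fun u v _ => (hexp u v).le
  · have hov := h5.sum_overlap_le hreg hd
    have hsplit : ∑ u, ∑ v ∈ G.neighborFinset u, (N u v / 3 - 2 * P u v)
        = 1 / 3 * (∑ u, ∑ v ∈ G.neighborFinset u, N u v)
          - 2 * (∑ u, ∑ v ∈ G.neighborFinset u, P u v) := by
      simp only [mul_sum, ← sum_sub_distrib]
      exact sum_congr rfl fun u _ => sum_congr rfl fun v _ => by ring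
    rw [hsplit] at hmain
    simp only [N, P, t] at hmain
    linarith
  · intro u
    have htu := (ht u).ne'
    simp only [sq, hexp]
    have h1 : P u u = 1 := by
      simp only [P, inter_self, htt]
      field_simp
    have h2 : 0 ≤ N u u := div_nonneg (mul_self_nonneg _) hn.le
    linarith
  · intro u v _
    exact div_nonneg (Nat.cast_nonneg _) (mul_nonneg (ht u).le (ht v).le)
  · intro u v _
    exact div_nonneg (mul_nonneg (ht u).le (ht v).le) hn.le

lemma CycleFree.card_mul_degree_pow_six_le (h5 : CycleFree G 5)
    (hreg : ∀ v, #(G.neighborFinset v) = d) (hd : 0 < d) [Nonempty V] :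
    0 ≤ surplus G ∧
      ((Fintype.card V : ℝ) * d) ^ 6 ≤ (600000000 * surplus G) ^ 7 := by
  have hd' : (0 : ℝ) < d := by exact_mod_cast hd
  have hn : (0 : ℝ) < Fintype.card V := by exact_mod_cast Fintype.card_pos
  have hs := fun u => Real.sqrt_pos.2 (h5.card_secondNeighbors_pos hreg hd u)
  have hr0 : ∀ u, 0 ≤ expansionRatio G d u := fun u => by
    rw [expansionRatio]; positivity
  have hR := h5.sum_expansionRatio_le_surplus hreg hd
  have hQ := h5.sum_sqrt_mul_sqrt_le_surplus hreg hd
  set n : ℝ := (Fintype.card V : ℝ) with hn_def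
  set R := ∑ u, expansionRatio G d u with hR_def
  have hR0 : 0 ≤ R := sum_nonneg fun u _ => hr0 u
  have hsp : 0 ≤ surplus G := by nlinarith [mul_nonneg hd'.le hR0]
  refine ⟨hsp, ?_⟩
  have h1 : n * √d ≤ 600000000 * surplus G := by
    have h : n ≤ √d * R := by
      rw [hR_def, mul_sum, hn_def, ← card_univ, ← nsmul_one, ← sum_const]
      exact sum_le_sum fun u _ => h5.one_le_sqrt_mul_expansionRatio hreg hd u
    have h' : n * √d ≤ d * R := by
      calc n * √d ≤ √d * R * √d := by gcongr
        _ = (√d * √d) * R := by ring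
        _ = d * R := by rw [Real.mul_self_sqrt hd'.le]
    linarith
  obtain ⟨k, hk0, hk⟩ : ∃ k : ℝ, 0 ≤ k ∧ k ^ 3 = d / n :=
    ⟨(d / n) ^ ((1 : ℝ) / 3), by positivity, by
      rw [← Real.rpow_natCast, ← Real.rpow_mul (by positivity)]; norm_num⟩
  have h2 : n * d * k ≤ 600000000 * surplus G := by
    have hterm : ∀ u v, k ≤ expansionRatio G d u + expansionRatio G d v
        + √(#(secondNeighbors G u)) * √(#(secondNeighbors G v)) / n := by
      intro u v
      have hu := hs u
      have hv := hs v
      have hprod : expansionRatio G d u * expansionRatio G d v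
          * (√(#(secondNeighbors G u)) * √(#(secondNeighbors G v)) / n) = k ^ 3 := by
        rw [hk, expansionRatio, expansionRatio]
        field_simp
        rw [Real.sq_sqrt hd'.le]
      have hc : 0 ≤ √(#(secondNeighbors G u)) * √(#(secondNeighbors G v)) / n := by positivity
      have ha := hr0 u
      have hb := hr0 v
      generalize expansionRatio G d u = a at *
      generalize expansionRatio G d v = b at *
      generalize √(#(secondNeighbors G u)) * √(#(secondNeighbors G v)) / n = c at *
      by_contra! hlt
      have h : a * b * c < k ^ 3 := by
        calc a * b * c ≤ (a + b + c) * (a + b + c) * (a + b + c) := by gcongr <;> linarith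
          _ = (a + b + c) ^ 3 := by ring
          _ < k ^ 3 := by gcongr
      linarith
    have hsum : ∑ u : V, ∑ v ∈ G.neighborFinset u, k ≤ ∑ u, ∑ v ∈ G.neighborFinset u,
        (expansionRatio G d u + expansionRatio G d v
          + √(#(secondNeighbors G u)) * √(#(secondNeighbors G v)) / n) :=
      sum_le_sum fun u _ => sum_le_sum fun v _ => hterm u v
    simp only [sum_add_distrib] at hsum
    rw [← sum_sum_neighborFinset_comm fun u v => expansionRatio G d u] at hsum
    simp only [sum_const, hreg, nsmul_eq_mul, ← mul_sum, card_univ] at hsum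
    rw [← hR_def, ← hn_def] at hsum
    linarith
  calc (n * d) ^ 6 = (n * √d) ^ 4 * (n * d * k) ^ 3 := by
        have : (√d : ℝ) ^ 4 = d ^ 2 := by
          rw [show (4 : ℕ) = 2 * 2 by rfl, pow_mul, Real.sq_sqrt hd'.le]
        rw [mul_pow n √d, this, mul_pow (n * d) k, hk]
        field_simp
    _ ≤ (600000000 * surplus G) ^ 4 * (600000000 * surplus G) ^ 3 := by gcongr
    _ = _ := by ring

end PentagonFree

/-- There is an absolute `c > 0` such that every regular `C₅`-free graph with `m`
edges has surplus at least `c · m^(6/7)`. -/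
theorem statement14 :
    ∃ c : ℝ, 0 < c ∧
      ∀ (V : Type) [Fintype V] (G : SimpleGraph V),
        (∃ d : ℕ, ∀ v : V, degC G v = d) →
        CycleFree G 5 →
        surplus G ≥ c * (edgeCount G : ℝ) ^ ((6 : ℝ) / 7) := by
  classical
  refine ⟨1 / 600000000, by norm_num, fun V _ G ⟨d, hdeg⟩ h5 => ?_⟩
  have hreg : ∀ v, #(G.neighborFinset v) = d := fun v => by
    rw [← hdeg v, degC, Nat.card_eq_fintype_card, SimpleGraph.card_neighborSet_eq_degree,
      SimpleGraph.card_neighborFinset_eq_degree]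
  have hm := two_mul_edgeCount G
  simp only [sum_const, hreg, nsmul_eq_mul, mul_one, card_univ] at hm
  rcases Nat.eq_zero_or_pos (edgeCount G) with h0 | hpos
  · simp [surplus, h0]
  have hm0 : (0 : ℝ) < edgeCount G := by exact_mod_cast hpos
  have hd : 0 < d := Nat.pos_of_ne_zero fun h => by
    rw [h] at hm
    norm_num at hm
    omega
  have hV : Nonempty V := by
    by_contra h
    rw [not_nonempty_iff] at h
    norm_num at hm
    omega
  obtain ⟨hsp, hle⟩ := h5.card_mul_degree_pow_six_le hreg hd
  rw [← hm] at hle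
  have hle' : (edgeCount G : ℝ) ^ 6 ≤ (600000000 * surplus G) ^ 7 :=
    le_trans (by gcongr; linarith) hle
  have key : ((edgeCount G : ℝ) ^ ((6 : ℝ) / 7)) ^ 7 ≤ (600000000 * surplus G) ^ 7 := by
    rw [← Real.rpow_natCast, ← Real.rpow_mul hm0.le]
    norm_num
    exact_mod_cast hle'
  have := le_of_pow_le_pow_left₀ (by norm_num) (by positivity) key
  linarith

end MaxCutPaper
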